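/- arXiv:math/9903012 — 2 statements merged into one kernel-verified Lean document; each statement's English description precedes it below -/
import Mathlib

section
/- Let q be an odd prime power and m a positive integer. The number of monic irreducible polynomials f of degree 2m over F_q satisfying f(z) = f(-z) equals the number of orbits of size 2m of the cyclic group C_{2m} acting on Z-words (a_1,...,a_m) with |a_i| ≤ (q-1)/2 via the twisted shift g(a_1,...,a_m) = (a_2,...,a_m,-a_1), restricted to fixed-point-free orbits. -/
open Polynomial

/-- The twisted shift `g(a_1,...,a_m) = (a_2,...,a_m,-a_1)` on `ℤ`-words of
length `m`. -/
def twistShift (m : ℕ) (a : Fin m → ℤ) : Fin m → ℤ := fun i =>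
  if h : (i : ℕ) + 1 < m then a ⟨(i : ℕ) + 1, h⟩
  else -(a ⟨0, Nat.lt_of_le_of_lt (Nat.zero_le _) i.isLt⟩)

/-- The twisted shift over an arbitrary alphabet with negation. -/
def twGen {R : Type*} [Neg R] (m : ℕ) (a : Fin m → R) : Fin m → R := fun i =>
  if h : (i : ℕ) + 1 < m then a ⟨(i : ℕ) + 1, h⟩
  else -(a ⟨0, Nat.lt_of_le_of_lt (Nat.zero_le _) i.isLt⟩)

lemma twGen_iter_lt {R : Type*} [Neg R] {m : ℕ} (u : Fin m → R) (k : ℕ) :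
    ∀ (i : ℕ) (h : i + k < m), ((twGen m)^[k] u) ⟨i, by omega⟩ = u ⟨i + k, h⟩ := by
  induction k with
  | zero => intro i h; rfl
  | succ k ih =>
    intro i h
    rw [Function.iterate_succ_apply']
    have h1 : i + 1 < m := by omega
    simp only [twGen, h1, dite_true]
    rw [ih (i + 1) (by omega)]
    congr 2
    omega

lemma twGen_iter_m {R : Type*} [Neg R] {m : ℕ} (u : Fin m → R) :
    (twGen m)^[m] u = fun i => - u i := by
  funext ⟨i, hi⟩
  have e : m = (m - 1 - i) + (i + 1) := by omega
  have h1 : (twGen m)^[m] u = (twGen m)^[m - 1 - i] ((twGen m)^[i + 1] u) := by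
    rw [← Function.iterate_add_apply, ← e]
  rw [h1, twGen_iter_lt _ _ i (by omega), Function.iterate_succ_apply']
  have h2 : ¬ (i + (m - 1 - i) + 1 < m) := by omega
  simp only [twGen, h2, dite_false]
  rw [twGen_iter_lt u i 0 (by omega)]
  simp

lemma twGen_iter_two_m {R : Type*} [InvolutiveNeg R] {m : ℕ} (u : Fin m → R) :
    (twGen m)^[2 * m] u = u := by
  rw [two_mul, Function.iterate_add_apply, twGen_iter_m, twGen_iter_m]
  simp

lemma twistShift_comp {R : Type*} [Neg R] {m : ℕ} (d : R → ℤ) (hd : ∀ x, d (-x) = - d x)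
    (u : Fin m → R) (k : ℕ) : (twistShift m)^[k] (d ∘ u) = d ∘ ((twGen m)^[k] u) := by
  have h : ∀ v : Fin m → R, twistShift m (d ∘ v) = d ∘ twGen m v := by
    intro v; funext i
    simp only [twistShift, twGen, Function.comp]
    split_ifs <;> simp [hd]
  induction k generalizing u with
  | zero => rfl
  | succ k ih => rw [Function.iterate_succ_apply, Function.iterate_succ_apply, h, ih]

/-- Odd bijection between a finite field of odd order and an interval of integers. -/
lemma exists_digits (F : Type*) [Field F] [Fintype F] (q : ℕ)
    (hq : Fintype.card F = q) (hodd : Odd q) :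
    ∃ d : F → ℤ, Function.Injective d ∧ (∀ x, d (-x) = - d x) ∧
      ∀ z : ℤ, |z| ≤ ((q : ℤ) - 1) / 2 ↔ ∃ x, d x = z := by
  classical
  have hne : ∀ x : F, -x = x → x = 0 := by
    intro x hx
    have h2 : ringChar F ≠ 2 := by
      intro h
      have := FiniteField.even_card_of_char_two h
      rw [hq] at this
      obtain ⟨k, hk⟩ := hodd
      omega
    exact (Ring.eq_self_iff_eq_zero_of_char_ne_two h2).1 hx
  let e := Fintype.equivFin F
  let S := {x : F // e x < e (-x)}
  let n := Fintype.card S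
  let s : S ≃ Fin n := Fintype.equivFin S
  let d : F → ℤ := fun x => if h : e x < e (-x) then ((s ⟨x, h⟩ : ℕ) : ℤ) + 1
    else if h : e (-x) < e (- -x) then - (((s ⟨-x, h⟩ : ℕ) : ℤ) + 1) else 0
  have d1 : ∀ x (h : e x < e (-x)), d x = ((s ⟨x, h⟩ : ℕ) : ℤ) + 1 := fun x h => by
    simp only [d, h, dite_true]
  have d0 : d 0 = 0 := by simp [d]
  have tri : ∀ x : F, x = 0 ∨ e x < e (-x) ∨ e (-x) < e (- -x) := by
    intro x
    rcases lt_trichotomy (e x) (e (-x)) with h | h | h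
    · exact Or.inr (Or.inl h)
    · exact Or.inl (hne x (e.injective h).symm)
    · exact Or.inr (Or.inr (by rwa [neg_neg]))
  have d2 : ∀ x (h : e (-x) < e (- -x)), d x = - (((s ⟨-x, h⟩ : ℕ) : ℤ) + 1) := fun x h => by
    have h' : ¬ e x < e (-x) := by rw [neg_neg] at h; exact not_lt.2 h.le
    simp only [d, h', dite_false]
    rw [dif_pos h]
  have dneg : ∀ x, d (-x) = - d x := by
    intro x
    rcases tri x with rfl | h | h
    · simp [d0]
    · have h' : e (- -x) < e (- - -x) := by simpa using h
      rw [d2 (-x) h', d1 x h]; simp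
    · rw [d1 (-x) h, d2 x h]; simp
  have dinj : Function.Injective d := by
    intro x y hxy
    rcases tri x with rfl | h | h <;> rcases tri y with rfl | h' | h'
    · rfl
    · rw [d0, d1 _ h'] at hxy; omega
    · rw [d0, d2 _ h'] at hxy; omega
    · rw [d0, d1 _ h] at hxy; omega
    · rw [d1 _ h, d1 _ h'] at hxy
      have : s ⟨x, h⟩ = s ⟨y, h'⟩ := by ext; omega
      exact congrArg Subtype.val (s.injective this)
    · rw [d1 _ h, d2 _ h'] at hxy; omega
    · rw [d0, d2 _ h] at hxy; omega
    · rw [d2 _ h, d1 _ h'] at hxy; omega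
    · rw [d2 _ h, d2 _ h'] at hxy
      have : s ⟨-x, h⟩ = s ⟨-y, h'⟩ := by ext; omega
      exact neg_injective (congrArg Subtype.val (s.injective this))
  have dpos : ∀ z : ℤ, 0 < z → z ≤ n → ∃ x, d x = z := by
    intro z hz hzn
    obtain ⟨x, hx⟩ := s.surjective ⟨(z - 1).toNat, by omega⟩
    refine ⟨x.1, ?_⟩
    rw [d1 x.1 x.2]
    have : (s ⟨x.1, x.2⟩ : ℕ) = (z - 1).toNat := by rw [Subtype.coe_eta, hx]
    omega
  have dran : ∀ z : ℤ, |z| ≤ n ↔ ∃ x, d x = z := by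
    intro z
    constructor
    · intro hz
      rw [abs_le] at hz
      rcases lt_trichotomy z 0 with h | h | h
      · obtain ⟨x, hx⟩ := dpos (-z) (by omega) (by omega)
        exact ⟨-x, by rw [dneg, hx, neg_neg]⟩
      · exact ⟨0, by rw [d0, h]⟩
      · exact dpos z h (by omega)
    · rintro ⟨x, rfl⟩
      rw [abs_le]
      rcases tri x with rfl | h | h
      · rw [d0]; omega
      · rw [d1 _ h]; have := (s ⟨x, h⟩).2; omega
      · rw [d2 _ h]; have := (s ⟨-x, h⟩).2; omega
  have hcard : q = 2 * n + 1 := by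
    have h1 : Finset.univ.image d = Finset.Icc (-(n : ℤ)) n := by
      ext z
      simp only [Finset.mem_image, Finset.mem_univ, true_and, Finset.mem_Icc]
      rw [← dran z, abs_le]
    have h2 := congrArg Finset.card h1
    rw [Finset.card_image_of_injective _ dinj, Finset.card_univ, hq, Int.card_Icc] at h2
    omega
  refine ⟨d, dinj, dneg, fun z => ?_⟩
  have : ((q : ℤ) - 1) / 2 = n := by omega
  rw [this, dran]

section
variable {F K : Type*} [Field F] [Fintype F] [Field K] [Finite K] [Algebra F K]

/-- Equivariant parametrisation of `{x | x ^ q ^ m = - x}` by words. -/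
lemma exists_theta (q m : ℕ) (hq : Fintype.card F = q)
    (hm : 1 ≤ m) (hK : Module.finrank F K = 2 * m) (φ : K ≃ₐ[F] K)
    (hφ : ∀ x, φ x = x ^ q) (hord : φ ^ (2 * m) = 1)
    (hgen : Function.Bijective fun n : Fin (2 * m) => φ ^ (n : ℕ)) :
    ∃ θ : (Fin m → F) → K, Function.Injective θ ∧ (∀ u, θ (twGen m u) = φ (θ u)) ∧
      ∀ x, (φ ^ m) x = -x ↔ ∃ u, θ u = x := by
  have hfin : FiniteDimensional F K := Module.Finite.of_finite
  obtain ⟨e, he⟩ : ∃ x : K, LinearIndependent F fun σ : K ≃ₐ[F] K => σ x := by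
    refine ⟨IsGalois.normalBasis F K 1, ?_⟩
    have h := (IsGalois.normalBasis F K).linearIndependent
    have h' : (⇑(IsGalois.normalBasis F K)) = fun σ : K ≃ₐ[F] K =>
        σ (IsGalois.normalBasis F K 1) := funext fun σ => IsGalois.normalBasis_apply σ
    rwa [h'] at h
  have hli : LinearIndependent F fun n : Fin (2 * m) => (φ⁻¹ ^ (n : ℕ)) e := by
    have hinj : Function.Injective fun n : Fin (2 * m) => φ⁻¹ ^ (n : ℕ) := by
      intro a b hab
      apply hgen.1
      simpa using hab
    exact he.comp _ hinj
  let w : (Fin m → F) → ℕ → F := fun u k => ((twGen m)^[k] u) ⟨0, hm⟩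
  let θ : (Fin m → F) → K := fun u => ∑ k ∈ Finset.range (2 * m), w u k • (φ⁻¹ ^ k) e
  have hinj : Function.Injective θ := by
    intro u v huv
    have h1 : ∑ n : Fin (2 * m), (w u n - w v n) • (φ⁻¹ ^ (n : ℕ)) e = 0 := by
      simp only [sub_smul, Finset.sum_sub_distrib]
      rw [Fin.sum_univ_eq_sum_range (fun k => w u k • (φ⁻¹ ^ k) e),
        Fin.sum_univ_eq_sum_range (fun k => w v k • (φ⁻¹ ^ k) e)]
      exact sub_eq_zero.2 huv
    have h2 := Fintype.linearIndependent_iff.1 hli _ h1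
    funext ⟨i, hi⟩
    have h3 := h2 ⟨i, by omega⟩
    simp only [w] at h3
    rw [twGen_iter_lt u i 0 (by omega), twGen_iter_lt v i 0 (by omega)] at h3
    simpa [sub_eq_zero] using h3
  have heq : ∀ u, θ (twGen m u) = φ (θ u) := by
    intro u
    obtain ⟨M, hM⟩ : ∃ M, 2 * m = M + 1 := ⟨2 * m - 1, by omega⟩
    have hw : ∀ k, w (twGen m u) k = w u (k + 1) := fun k => by
      simp only [w, Function.iterate_succ_apply]
    have hw0 : w u (M + 1) = w u 0 := by
      simp only [w]; rw [← hM, twGen_iter_two_m]; rfl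
    have hs : ∀ k, φ ((φ⁻¹ ^ (k + 1)) e) = (φ⁻¹ ^ k) e := fun k => by
      rw [pow_succ', AlgEquiv.mul_apply, ← AlgEquiv.mul_apply φ, mul_inv_cancel]; rfl
    have hl : (φ⁻¹ ^ M) e = φ e := by
      rw [← hs M, ← hM, inv_pow, hord]; simp
    simp only [θ, map_sum, map_smul, hM, hw]
    rw [Finset.sum_range_succ, Finset.sum_range_succ' (n := M)]
    simp only [hs]
    rw [hw0, hl]; simp
  have hpow : ∀ k x, (φ ^ k) x = x ^ q ^ k := by
    intro k
    induction k with
    | zero => intro x; simp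
    | succ k ih => intro x; rw [pow_succ', AlgEquiv.mul_apply, ih, hφ, ← pow_mul, pow_succ]
  have hit : ∀ k u, θ ((twGen m)^[k] u) = (φ ^ k) (θ u) := by
    intro k
    induction k with
    | zero => intro u; simp
    | succ k ih =>
      intro u
      rw [Function.iterate_succ_apply', heq, ih, pow_succ', AlgEquiv.mul_apply]
  have hneg : ∀ u, θ (fun i => - u i) = - θ u := by
    have hlin : ∀ u k, w (fun i => - u i) k = - w u k := by
      intro u k
      have : ∀ k, (twGen m)^[k] (fun i => - u i) = fun i => - ((twGen m)^[k] u i) := by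
        intro k
        rw [← twGen_iter_m u, ← twGen_iter_m, ← Function.iterate_add_apply,
          ← Function.iterate_add_apply, add_comm]
      simp only [w, this]
    intro u
    simp only [θ, hlin, neg_smul, Finset.sum_neg_distrib]
  have hV : ∀ u, (φ ^ m) (θ u) = - θ u := by
    intro u; rw [← hit, twGen_iter_m, hneg]
  refine ⟨θ, hinj, heq, ?_⟩
  have hq1 : 1 < q := hq ▸ Fintype.one_lt_card
  have hqm : 1 < q ^ m := Nat.one_lt_pow (by omega) hq1
  let P : K[X] := X ^ (q ^ m) + X
  have hdeg : P.natDegree = q ^ m := by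
    simp only [P]
    rw [natDegree_add_eq_left_of_natDegree_lt] <;> simp [hqm]
  have hP0 : P ≠ 0 := by
    intro h; rw [h] at hdeg; simp at hdeg; omega
  have hsub : Set.range θ ⊆ {x | (φ ^ m) x = -x} := by
    rintro _ ⟨u, rfl⟩; exact hV u
  have hsubP : {x | (φ ^ m) x = -x} ⊆ (P.rootSet K : Set K) := by
    intro x hx
    rw [Polynomial.mem_rootSet]
    refine ⟨hP0, ?_⟩
    have : x ^ q ^ m = -x := by rw [← hpow]; exact hx
    simp [P, this]
  have hcard : ({x | (φ ^ m) x = -x} : Set K).ncard ≤ (Set.range θ).ncard := by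
    calc _ ≤ (P.rootSet K).ncard := Set.ncard_le_ncard hsubP (Set.toFinite _)
      _ ≤ P.natDegree := by
        exact Polynomial.ncard_rootSet_le P K
      _ = q ^ m := hdeg
      _ = (Set.range θ).ncard := by
        rw [← Set.image_univ, Set.ncard_image_of_injective _ hinj, Set.ncard_univ,
          Nat.card_eq_fintype_card, Fintype.card_fun, hq, Fintype.card_fin]
  have := Set.eq_of_subset_of_ncard_le hsub hcard (Set.toFinite _)
  intro x
  exact (Set.ext_iff.1 this x).symm

end

section
variable {F K : Type*} [Field F] [Fintype F] [Field K] [Finite K] [Algebra F K]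

lemma minpoly_eq_iff_frob (φ : K ≃ₐ[F] K) (hgen : ∀ σ : K ≃ₐ[F] K, ∃ k : ℕ, φ ^ k = σ) (x y : K) :
    aeval y (minpoly F x) = 0 ↔ ∃ k : ℕ, (φ ^ k) x = y := by
  have hfin : FiniteDimensional F K := Module.Finite.of_finite
  constructor
  · intro h
    have h1 : minpoly F x = minpoly F y :=
      minpoly.eq_of_irreducible_of_monic (minpoly.irreducible (Algebra.IsIntegral.isIntegral x)) h
        (minpoly.monic (Algebra.IsIntegral.isIntegral x))
    obtain ⟨σ, hσ⟩ := (Normal.minpoly_eq_iff_mem_orbit K).1 h1.symm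
    obtain ⟨k, rfl⟩ := hgen σ
    exact ⟨k, hσ⟩
  · rintro ⟨k, rfl⟩
    rw [← minpoly.algEquiv_eq (φ ^ k) x]
    exact minpoly.aeval _ _

lemma ncard_roots (x : K) :
    {y : K | aeval y (minpoly F x) = 0}.ncard = (minpoly F x).natDegree := by
  classical
  have hfin : FiniteDimensional F K := Module.Finite.of_finite
  have := Fintype.ofFinite K
  have hx := Algebra.IsIntegral.isIntegral (R := F) x
  rw [← Polynomial.card_rootSet_eq_natDegree (K := K) (p := minpoly F x)
    (IsGalois.separable F x) (IsGalois.splits F x)]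
  rw [← Nat.card_eq_fintype_card, Nat.card_coe_set_eq]
  congr 1
  ext y
  simp [Polynomial.mem_rootSet, minpoly.ne_zero hx]

lemma frob_m_eq_neg (m : ℕ) (hm : 1 ≤ m) (hK : Module.finrank F K = 2 * m) (φ : K ≃ₐ[F] K)
    (hord : orderOf φ = 2 * m) (hne : ∀ x : K, -x = x → x = 0)
    (x : K) (hx : (minpoly F x).natDegree = 2 * m) (k : ℕ) (hk : (φ ^ k) x = -x) :
    (φ ^ m) x = -x := by
  have hfin : FiniteDimensional F K := Module.Finite.of_finite
  have htop : IntermediateField.adjoin F {x} = ⊤ :=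
    (Field.primitive_element_iff_minpoly_natDegree_eq F x).2 (hx.trans hK.symm)
  have hx0 : x ≠ 0 := by
    rintro rfl
    rw [minpoly.zero] at hx; simp at hx; omega
  have h2 : (φ ^ (2 * k)) x = x := by
    rw [two_mul, pow_add, AlgEquiv.mul_apply, hk, map_neg, hk, neg_neg]
  have h3 : φ ^ (2 * k) = 1 := by
    have h4 : ∀ y, y ∈ IntermediateField.adjoin F {x} → (φ ^ (2 * k)) y = y := by
      intro y hy
      induction hy using IntermediateField.adjoin_induction with
      | mem z hz => rw [Set.mem_singleton_iff.1 hz]; exact h2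
      | algebraMap z => simp
      | add a b _ _ ha hb => rw [map_add, ha, hb]
      | inv a _ ha => rw [map_inv₀, ha]
      | mul a b _ _ ha hb => rw [map_mul, ha, hb]
    ext y
    exact h4 y (htop ▸ IntermediateField.mem_top)
  have h5 : m ∣ k := by
    have := orderOf_dvd_of_pow_eq_one h3
    rw [hord] at this
    exact Nat.dvd_of_mul_dvd_mul_left two_pos this
  obtain ⟨t, rfl⟩ := h5
  have h1 : φ ^ (2 * m) = 1 := by rw [← hord]; exact pow_orderOf_eq_one φ
  rcases Nat.even_or_odd' t with ⟨s, rfl | rfl⟩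
  · exfalso
    rw [show m * (2 * s) = 2 * m * s by ring, pow_mul, h1, one_pow] at hk
    exact hx0 (hne x hk.symm)
  · rwa [show m * (2 * s + 1) = 2 * m * s + m by ring, pow_add, pow_mul, h1, one_pow,
      one_mul] at hk

theorem card_aux (q m : ℕ)
    (hq : Fintype.card F = q) (hodd : Odd q) (hm : 1 ≤ m) (hK : Module.finrank F K = 2 * m) :
    Nat.card {f : F[X] //
        f.Monic ∧ Irreducible f ∧ f.natDegree = 2 * m ∧ f.comp (-X) = f} =
      Nat.card {o : Set (Fin m → ℤ) //
        ∃ a : Fin m → ℤ, (∀ i, |a i| ≤ ((q : ℤ) - 1) / 2) ∧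
          o = {b | ∃ k : ℕ, (twistShift m)^[k] a = b} ∧ o.ncard = 2 * m} := by
  have hfin : FiniteDimensional F K := Module.Finite.of_finite
  have hne : ∀ x : K, -x = x → x = 0 := by
    intro x hx
    have h2 : ringChar K ≠ 2 := by
      intro h
      rw [← Algebra.ringChar_eq F K] at h
      have := FiniteField.even_card_of_char_two h
      rw [hq] at this
      obtain ⟨k, hk⟩ := hodd
      omega
    exact (Ring.eq_self_iff_eq_zero_of_char_ne_two h2).1 hx
  obtain ⟨d, dinj, dneg, dran⟩ := exists_digits F q hq hodd
  let φ : K ≃ₐ[F] K := FiniteField.frobeniusAlgEquivOfAlgebraic F K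
  have hφ : ∀ x, φ x = x ^ q := fun x => by
    rw [← hq]; exact congrFun (FiniteField.coe_frobeniusAlgEquivOfAlgebraic F K) x
  have hord : orderOf φ = 2 * m := by
    rw [← hK]; exact FiniteField.orderOf_frobeniusAlgEquivOfAlgebraic F K
  have hbij : Function.Bijective fun n : Fin (2 * m) => φ ^ (n : ℕ) := by
    rw [← hK]; exact FiniteField.bijective_frobeniusAlgEquivOfAlgebraic_pow F K
  have hgen : ∀ σ : K ≃ₐ[F] K, ∃ k : ℕ, φ ^ k = σ := fun σ => by
    obtain ⟨n, hn⟩ := hbij.2 σ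
    exact ⟨n, hn⟩
  obtain ⟨θ, θinj, θeq, θran⟩ := exists_theta (K := K) q m hq hm hK φ hφ
    (by rw [← hord]; exact pow_orderOf_eq_one φ) hbij
  have hit : ∀ k u, θ ((twGen m)^[k] u) = (φ ^ k) (θ u) := by
    intro k
    induction k with
    | zero => intro u; simp
    | succ k ih =>
      intro u
      rw [Function.iterate_succ_apply', θeq, ih, pow_succ', AlgEquiv.mul_apply]
  let G : F[X] → Set (Fin m → ℤ) := fun f => {b | ∃ u : Fin m → F, d ∘ u = b ∧ aeval (θ u) f = 0}
  have dcinj : Function.Injective fun u : Fin m → F => d ∘ u := dinj.comp_left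
  -- the set attached to a minimal polynomial is an orbit
  have hG : ∀ u, G (minpoly F (θ u)) = {b | ∃ k : ℕ, (twistShift m)^[k] (d ∘ u) = b} := by
    intro u
    ext b
    simp only [G, Set.mem_setOf_eq, twistShift_comp d dneg, minpoly_eq_iff_frob φ hgen, ← hit]
    constructor
    · rintro ⟨v, rfl, k, hk⟩
      exact ⟨k, by rw [θinj hk]⟩
    · rintro ⟨k, rfl⟩
      exact ⟨_, rfl, k, rfl⟩
  have hGcard : ∀ u, (G (minpoly F (θ u))).ncard = (minpoly F (θ u)).natDegree := by
    intro u
    have h1 : G (minpoly F (θ u)) = (fun v : Fin m → F => d ∘ v) ''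
        {v | aeval (θ v) (minpoly F (θ u)) = 0} := by
      ext b; simp only [G, Set.mem_setOf_eq, Set.mem_image]
      exact exists_congr fun v => and_comm
    have h2 : θ '' {v | aeval (θ v) (minpoly F (θ u)) = 0} =
        {y | aeval y (minpoly F (θ u)) = 0} := by
      ext y
      constructor
      · rintro ⟨v, hv, rfl⟩; exact hv
      · intro hy
        obtain ⟨k, rfl⟩ := (minpoly_eq_iff_frob φ hgen _ _).1 hy
        rw [← hit] at hy ⊢
        exact ⟨_, hy, rfl⟩
    rw [h1, Set.ncard_image_of_injective _ dcinj, ← Set.ncard_image_of_injective _ θinj, h2,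
      ncard_roots]
  -- every even irreducible polynomial is such a minimal polynomial
  have hP : ∀ f : F[X], f.Monic ∧ Irreducible f ∧ f.natDegree = 2 * m ∧ f.comp (-X) = f →
      ∃ u, f = minpoly F (θ u) := by
    rintro f ⟨hmon, hirr, hdeg, hev⟩
    obtain ⟨x, hx⟩ : ∃ x : K, aeval x f = 0 := by
      have hs := (hirr.natDegree_dvd_iff_dvd_X_pow_card_pow_sub_X (n := 2 * m)).1 (by rw [hdeg])
      have hKc : Nat.card K = Nat.card F ^ (2 * m) := by
        rw [Module.natCard_eq_pow_finrank (K := F), hK]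
      have := Fintype.ofFinite K
      have hsp : ((X ^ (Nat.card F) ^ (2 * m) - X : F[X]).map (algebraMap F K)).Splits := by
        rw [← hKc, Nat.card_eq_fintype_card]
        exact (FiniteField.isSplittingField_sub K F).splits
      have hne0 : (X ^ (Nat.card F) ^ (2 * m) - X : F[X]) ≠ 0 := by
        rw [← hKc]
        exact FiniteField.X_pow_card_sub_X_ne_zero F Finite.one_lt_card
      have hsf := hsp.of_dvd (by rwa [Polynomial.map_ne_zero_iff (algebraMap F K).injective])
        (Polynomial.map_dvd (algebraMap F K) hs)
      obtain ⟨x, hx⟩ := hsf.exists_eval_eq_zero (by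
        rw [Polynomial.degree_map]; exact (Irreducible.degree_pos hirr).ne')
      exact ⟨x, by rwa [Polynomial.eval_map_algebraMap] at hx⟩
    have hfx : f = minpoly F x := minpoly.eq_of_irreducible_of_monic hirr hx hmon
    have hnx : aeval (-x) (minpoly F x) = 0 := by
      rw [← hfx]
      have : aeval x (f.comp (-X)) = 0 := by rw [hev, hx]
      rwa [Polynomial.aeval_comp, map_neg, aeval_X] at this
    obtain ⟨k, hk⟩ := (minpoly_eq_iff_frob φ hgen _ _).1 hnx
    have := frob_m_eq_neg m hm hK φ hord hne x (by rw [← hfx, hdeg]) k hk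
    obtain ⟨u, rfl⟩ := (θran x).1 this
    exact ⟨u, hfx⟩
  refine Nat.card_congr (Equiv.ofBijective (fun f => ⟨G f.1, ?_⟩) ⟨?_, ?_⟩)
  · obtain ⟨f, hf⟩ := f
    obtain ⟨u, rfl⟩ := hP f hf
    refine ⟨d ∘ u, fun i => (dran _).2 ⟨u i, rfl⟩, hG u, ?_⟩
    rw [hGcard, hf.2.2.1]
  · rintro ⟨f, hf⟩ ⟨g, hg⟩ hfg
    have hfg' : G f = G g := congrArg Subtype.val hfg
    obtain ⟨u, hu⟩ := hP f hf
    have h1 : d ∘ u ∈ G f := ⟨u, rfl, by rw [hu]; exact minpoly.aeval _ _⟩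
    rw [hfg'] at h1
    obtain ⟨v, hv, hv'⟩ := h1
    have : v = u := dcinj hv
    subst this
    apply Subtype.ext
    change f = g
    rw [hu, minpoly.eq_of_irreducible_of_monic hg.2.1 hv' hg.1]
  · rintro ⟨o, a, ha, ho, hcard⟩
    choose u hu using fun i => (dran (a i)).1 (ha i)
    have hua : d ∘ u = a := funext hu
    have hGo : G (minpoly F (θ u)) = o := by rw [hG, hua, ho]
    have hint := Algebra.IsIntegral.isIntegral (R := F) (θ u)
    have hdeg : (minpoly F (θ u)).natDegree = 2 * m := by rw [← hGcard, hGo, hcard]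
    refine ⟨⟨minpoly F (θ u), minpoly.monic hint, minpoly.irreducible hint, hdeg, ?_⟩,
      Subtype.ext hGo⟩
    have h1 : aeval (-θ u) (minpoly F (θ u)) = 0 :=
      (minpoly_eq_iff_frob φ hgen _ _).2 ⟨m, (θran _).2 ⟨u, rfl⟩⟩
    have hnd : ((minpoly F (θ u)).comp (-X)).natDegree = 2 * m := by
      rw [natDegree_comp, natDegree_neg, natDegree_X, mul_one, hdeg]
    have hmon : ((minpoly F (θ u)).comp (-X)).Monic := by
      rw [Monic, leadingCoeff_comp (by simp), (minpoly.monic hint).leadingCoeff, hdeg]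
      simp
    have hdvd : minpoly F (θ u) ∣ (minpoly F (θ u)).comp (-X) := by
      apply minpoly.dvd
      rw [Polynomial.aeval_comp, map_neg, aeval_X, h1]
    exact (Polynomial.eq_of_monic_of_dvd_of_natDegree_le (minpoly.monic hint) hmon hdvd
      (by rw [hnd, hdeg]))

end

/-- Over a finite field of odd order `q`, the number of monic irreducible
polynomials `f` of degree `2m` with `f(z) = f(-z)` equals the number of
fixed-point-free orbits (orbits of size `2m`) of the cyclic group `C_{2m}`
acting by the twisted shift on `ℤ`-words `(a_1,...,a_m)` with
`|a_i| ≤ (q-1)/2`. -/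
theorem card_irreducible_even_eq_card_twisted_necklaces
    (F : Type*) [Field F] [Fintype F] (q m : ℕ)
    (hq : Fintype.card F = q) (hodd : Odd q) (hm : 1 ≤ m) :
    Nat.card {f : F[X] //
        f.Monic ∧ Irreducible f ∧ f.natDegree = 2 * m ∧ f.comp (-X) = f} =
      Nat.card {o : Set (Fin m → ℤ) //
        ∃ a : Fin m → ℤ, (∀ i, |a i| ≤ ((q : ℤ) - 1) / 2) ∧
          o = {b | ∃ k : ℕ, (twistShift m)^[k] a = b} ∧ o.ncard = 2 * m} := by
  obtain ⟨p, hp⟩ := CharP.exists F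
  have : Fact p.Prime := ⟨CharP.char_is_prime F p⟩
  have : NeZero (2 * m) := ⟨by omega⟩
  exact card_aux (K := FiniteField.Extension F p (2 * m)) q m hq hodd hm
    (FiniteField.finrank_extension F p (2 * m))
end

section
/- Let q be an odd prime power and m ≥ 1. The number of unordered pairs {f(z), g(z)} of monic irreducible polynomials of degree m over F_q with g(z) = (-1)^m f(-z) and f ≠ g, plus the number of monic irreducible degree-m polynomials f with (-1)^m f(-z) = f(z), equals the number of orbits of the group Z_2 × C_m acting on Z-words (a_1,...,a_m) with entries in [-(q-1)/2,(q-1)/2], where C_m acts by cyclic shift and Z_2 acts by negating all entries, restricted to orbits on which the C_m-action is free. -/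
open Polynomial

/-- For a polynomial `φ(z)` of degree `d`, its reflection `φ̃(z) = (-1)^d φ(-z)`. -/
noncomputable def pdual {F : Type*} [Field F] (φ : F[X]) : F[X] :=
  C ((-1 : F) ^ φ.natDegree) * φ.comp (-X)

/-- The cyclic shift `(a_1,...,a_m) ↦ (a_2,...,a_m,a_1)` on `ℤ`-words of
length `m`. -/
def cycShift (m : ℕ) (a : Fin m → ℤ) : Fin m → ℤ := fun i =>
  a ⟨((i : ℕ) + 1) % m, Nat.mod_lt _ (Nat.lt_of_le_of_lt (Nat.zero_le _) i.isLt)⟩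

/-- An odd bijection from a finite field of odd order onto the symmetric integer interval. -/
lemma exists_odd_coding (F : Type*) [Field F] [Fintype F] (q : ℕ)
    (hq : Fintype.card F = q) (hodd : Odd q) :
    ∃ c : F → ℤ, Function.Injective c ∧ (∀ x, c (-x) = -c x) ∧
      (∀ z : ℤ, |z| ≤ ((q : ℤ) - 1) / 2 ↔ ∃ x, c x = z) := by
  classical
  have h2 : (2 : F) ≠ 0 := by
    have hc : ringChar F ≠ 2 := by
      intro h
      have := FiniteField.even_card_of_char_two h
      rw [hq] at this
      rcases hodd with ⟨k, hk⟩
      omega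
    exact Ring.two_ne_zero hc
  have hneg : ∀ x : F, x = -x → x = 0 := by
    intro x hx
    have : (2 : F) * x = 0 := by linear_combination hx
    exact (mul_eq_zero.mp this).resolve_left h2
  let r : F ≃ Fin (Fintype.card F) := Fintype.equivFin F
  let P : Finset F := Finset.univ.filter fun x => r x < r (-x)
  have hP : ∀ x, x ∈ P ↔ r x < r (-x) := by intro x; simp [P]
  have htri : ∀ x : F, x ≠ 0 → x ∉ P → -x ∈ P := by
    intro x hx hxP
    rw [hP] at hxP ⊢
    rw [neg_neg]
    refine lt_of_le_of_ne (not_lt.mp hxP) ?_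
    intro h
    exact hx (hneg x (r.injective h).symm)
  have hexc : ∀ x : F, x ∈ P → -x ∉ P := by
    intro x h1 h2
    rw [hP] at h1 h2
    rw [neg_neg] at h2
    exact lt_asymm h1 h2
  have h0 : (0 : F) ∉ P := by rw [hP]; simp
  let e : P ≃ Fin P.card := P.equivFin
  let c : F → ℤ := fun x => if h : x ∈ P then ((e ⟨x, h⟩ : ℕ) : ℤ) + 1
    else if h : -x ∈ P then -(((e ⟨-x, h⟩ : ℕ) : ℤ) + 1) else 0
  have cP : ∀ x (h : x ∈ P), c x = ((e ⟨x, h⟩ : ℕ) : ℤ) + 1 := by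
    intro x h; simp only [c]; rw [dif_pos h]
  have c0 : c 0 = 0 := by simp [c, h0]
  have cneg : ∀ x, c (-x) = - c x := by
    intro x
    by_cases h : x ∈ P
    · have h' := hexc x h
      rw [cP x h]
      simp [c, h, h']
    · by_cases h' : -x ∈ P
      · rw [cP _ h']
        simp [c, h, h']
      · simp [c, h, h']
  have cinjP : ∀ x y, x ∈ P → c x = c y → x = y := by
    intro x y hx hxy
    by_cases hy : y ∈ P
    · rw [cP x hx, cP y hy] at hxy
      have : e ⟨x, hx⟩ = e ⟨y, hy⟩ := Fin.ext (by omega)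
      simpa using e.injective this
    · by_cases hy0 : y = 0
      · subst hy0
        rw [cP x hx, c0] at hxy
        omega
      · have h := htri y hy0 hy
        have h3 := cneg y
        rw [cP _ h] at h3
        rw [cP x hx] at hxy
        omega
  have cinj : Function.Injective c := by
    intro x y hxy
    by_cases hx : x ∈ P
    · exact cinjP x y hx hxy
    · by_cases hx0 : x = 0
      · by_cases hy : y ∈ P
        · exact (cinjP y x hy hxy.symm).symm
        · by_cases hy0 : y = 0
          · rw [hx0, hy0]
          · have h := cinjP (-y) (-x) (htri y hy0 hy) (by rw [cneg, cneg, hxy])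
            exact (neg_injective h).symm
      · have h := cinjP (-x) (-y) (htri x hx0 hx) (by rw [cneg, cneg, hxy])
        exact neg_injective h
  have hpos : ∀ z : ℤ, 0 < z → z ≤ P.card → ∃ x, c x = z := by
    intro z hz hz'
    let y := e.symm ⟨(z - 1).toNat, by omega⟩
    refine ⟨y.1, ?_⟩
    rw [cP y.1 y.2]
    simp only [y, Subtype.coe_eta, Equiv.apply_symm_apply]
    omega
  have hrange : ∀ z : ℤ, |z| ≤ P.card ↔ ∃ x, c x = z := by
    intro z
    constructor
    · intro hz
      rw [abs_le] at hz
      rcases lt_trichotomy z 0 with h | h | h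
      · obtain ⟨x, hx⟩ := hpos (-z) (by omega) (by omega)
        exact ⟨-x, by rw [cneg, hx, neg_neg]⟩
      · exact ⟨0, by rw [c0, h]⟩
      · exact hpos z h hz.2
    · rintro ⟨x, rfl⟩
      have hb : ∀ y ∈ P, |c y| ≤ P.card := by
        intro y hy
        rw [cP y hy, abs_le]
        have := (e ⟨y, hy⟩).2
        omega
      by_cases hx : x ∈ P
      · exact hb x hx
      · by_cases hx0 : x = 0
        · rw [hx0, c0]; simp
        · have := hb _ (htri x hx0 hx)
          rwa [cneg, abs_neg] at this
  have hcard : (q : ℤ) = 2 * P.card + 1 := by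
    have h1 : Finset.univ.image c = Finset.Icc (-(P.card : ℤ)) P.card := by
      ext z
      rw [Finset.mem_Icc, ← abs_le, hrange]
      simp
    have h2 := congrArg Finset.card h1
    rw [Finset.card_image_of_injective _ cinj, Int.card_Icc, Finset.card_univ, hq] at h2
    omega
  refine ⟨c, cinj, cneg, fun z => ?_⟩
  rw [← hrange, hcard]
  have : (2 * (P.card : ℤ) + 1 - 1) / 2 = P.card := by omega
  rw [this]

/-- A degree-`m` extension with its Frobenius and an equivariant coding by integer words. -/
lemma exists_word_coding (F : Type*) [Field F] [Fintype F] (q m : ℕ)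
    (hq : Fintype.card F = q) (hodd : Odd q) (hm : 1 ≤ m)
    (K : Type*) [Field K] [Finite K] [Algebra F K] (hK : Module.finrank F K = m) :
    ∃ w : K → (Fin m → ℤ), Function.Injective w ∧ (∀ x, w (-x) = -w x) ∧
      (∀ x, w (FiniteField.frobeniusAlgEquivOfAlgebraic F K x) = cycShift m (w x)) ∧
      (∀ a : Fin m → ℤ, (∀ i, |a i| ≤ ((q : ℤ) - 1) / 2) ↔ ∃ x, w x = a) := by
  obtain ⟨c, cinj, cneg, crange⟩ := exists_odd_coding F q hq hodd
  let σ := FiniteField.frobeniusAlgEquivOfAlgebraic F K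
  have hσ : orderOf σ = m := by
    rw [← hK]; exact FiniteField.orderOf_frobeniusAlgEquivOfAlgebraic F K
  let B := IsGalois.normalBasis F K
  have hbij : Function.Bijective fun n : Fin m => (σ ^ (n : ℕ))⁻¹ := by
    have h := FiniteField.bijective_frobeniusAlgEquivOfAlgebraic_pow F K
    rw [hK] at h
    exact (Equiv.inv _).bijective.comp h
  let g : Fin m ≃ Gal(K/F) := Equiv.ofBijective _ hbij
  have hg : ∀ i, g i = (σ ^ (i : ℕ))⁻¹ := fun i => rfl
  have hrepr : ∀ (x : K) (τ : Gal(K/F)), B.repr (σ x) τ = B.repr x (σ⁻¹ * τ) := by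
    intro x τ
    let L1 : K →ₗ[F] F := (B.coord τ).comp σ.toLinearMap
    have : L1 = B.coord (σ⁻¹ * τ) := by
      apply B.ext
      intro ρ
      have h1 : σ (B ρ) = B (σ * ρ) := by
        simp only [B]
        rw [IsGalois.normalBasis_apply ρ, IsGalois.normalBasis_apply (σ * ρ)]
        rfl
      simp only [L1, LinearMap.comp_apply, AlgEquiv.toLinearMap_apply, h1, Module.Basis.coord_apply,
        Module.Basis.repr_self]
      classical
      rw [Finsupp.single_apply, Finsupp.single_apply]
      congr 1
      rw [eq_inv_mul_iff_mul_eq]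
    exact LinearMap.congr_fun this x
  refine ⟨fun x i => c (B.repr x (g i)), ?_, ?_, ?_, ?_⟩
  · intro x y hxy
    apply B.repr.injective
    ext τ
    obtain ⟨i, rfl⟩ := g.surjective τ
    exact cinj (congrFun hxy i)
  · intro x
    ext i
    simp [cneg]
  · intro x
    ext i
    simp only [cycShift]
    rw [hrepr x (g i)]
    congr 2
    rw [hg, hg]
    simp only
    have hmod : σ ^ (((i : ℕ) + 1) % m) = σ ^ ((i : ℕ) + 1) := by
      have := pow_mod_orderOf σ ((i : ℕ) + 1)
      rwa [hσ] at this
    rw [hmod, pow_succ, mul_inv_rev]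
  · intro a
    constructor
    · intro ha
      choose y hy using fun i => (crange (a i)).mp (ha i)
      refine ⟨B.equivFun.symm (fun τ => y (g.symm τ)), ?_⟩
      ext i
      have := congrFun (B.equivFun.apply_symm_apply (fun τ => y (g.symm τ))) (g i)
      rw [Module.Basis.equivFun_apply] at this
      show c (B.repr _ (g i)) = a i
      rw [this]
      simp [hy]
    · rintro ⟨x, rfl⟩ i
      exact (crange _).mpr ⟨_, rfl⟩

lemma pdual_minpoly (F : Type*) [Field F] {K : Type*} [Field K] [Algebra F K] (x : K) :
    pdual (minpoly F x) = minpoly F (-x) := by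
  rw [minpoly.neg, pdual]
  simp

lemma natDegree_minpoly_neg (F : Type*) [Field F] {K : Type*} [Field K] [Algebra F K] [Finite K]
    [FiniteDimensional F K] (x : K) :
    (minpoly F (-x)).natDegree = (minpoly F x).natDegree := by
  rw [← pdual_minpoly, pdual, Polynomial.natDegree_C_mul (pow_ne_zero _ (by simp)),
    Polynomial.natDegree_comp]
  simp

lemma minpoly_eq_iff_frob_s14 (F : Type*) [Field F] [Fintype F] {K : Type*} [Field K] [Algebra F K]
    [Finite K] (x y : K) :
    minpoly F y = minpoly F x ↔
      ∃ k : ℕ, y = (FiniteField.frobeniusAlgEquivOfAlgebraic F K)^[k] x := by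
  rw [Normal.minpoly_eq_iff_mem_orbit K]
  constructor
  · rintro ⟨g, hg⟩
    obtain ⟨n, rfl⟩ := (FiniteField.bijective_frobeniusAlgEquivOfAlgebraic_pow F K).2 g
    refine ⟨n, ?_⟩
    rw [← hg, ← AlgEquiv.coe_pow]
    rfl
  · rintro ⟨k, rfl⟩
    refine ⟨FiniteField.frobeniusAlgEquivOfAlgebraic F K ^ k, ?_⟩
    rw [← AlgEquiv.coe_pow]
    rfl

lemma natDegree_minpoly_eq_iff_frob (F : Type*) [Field F] [Fintype F] {K : Type*} [Field K]
    [Algebra F K] [Finite K] (m : ℕ) (hK : Module.finrank F K = m) (x : K) :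
    (minpoly F x).natDegree = m ↔
      ∀ k : ℕ, 0 < k → k < m → (FiniteField.frobeniusAlgEquivOfAlgebraic F K)^[k] x ≠ x := by
  have hord : orderOf (FiniteField.frobeniusAlgEquivOfAlgebraic F K) = m := by
    rw [← hK]; exact FiniteField.orderOf_frobeniusAlgEquivOfAlgebraic F K
  rw [← hK, ← Field.primitive_element_iff_minpoly_natDegree_eq,
    Field.primitive_element_iff_algHom_eq_of_eval F K
      (fun y => Normal.splits inferInstance y) x (AlgHom.id F K), hK]
  constructor
  · intro h k hk0 hkm hx
    have h1 := h ((FiniteField.frobeniusAlgEquivOfAlgebraic F K ^ k : Gal(K/F)) : K →ₐ[F] K) (by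
      rw [← AlgEquiv.coe_pow] at hx
      exact hx.symm)
    have h2 : FiniteField.frobeniusAlgEquivOfAlgebraic F K ^ k = 1 := by
      ext y
      exact (DFunLike.congr_fun h1 y).symm
    exact pow_ne_one_of_lt_orderOf hk0.ne' (by rw [hord]; exact hkm) h2
  · intro h ψ hψ
    obtain ⟨n, hn⟩ := (FiniteField.bijective_frobeniusAlgHom_pow F K).2 ψ
    have hcoe : ∀ y, ψ y = (FiniteField.frobeniusAlgEquivOfAlgebraic F K)^[(n : ℕ)] y := by
      intro y
      rw [← hn]
      simp only [AlgHom.coe_pow]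
      rfl
    by_cases h0 : (n : ℕ) = 0
    · ext y
      rw [hcoe, h0]
      rfl
    · exact absurd ((hcoe x).symm.trans hψ.symm) (h n (Nat.pos_of_ne_zero h0) (hK ▸ n.2))

lemma exists_root_of_degree (F : Type*) [Field F] [Fintype F] {K : Type*} [Field K]
    [Algebra F K] [Finite K] (m : ℕ) (hK : Module.finrank F K = m) (f : F[X])
    (hf : f.Monic) (hi : Irreducible f) (hd : f.natDegree = m) :
    ∃ x : K, minpoly F x = f := by
  haveI : Fact (Irreducible f) := ⟨hi⟩
  have hr : Module.finrank F (AdjoinRoot f) = m := by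
    rw [(AdjoinRoot.powerBasis hi.ne_zero).finrank, AdjoinRoot.powerBasis_dim, hd]
  obtain ⟨φ⟩ := FiniteField.nonempty_algHom_of_finrank_dvd (F := F) (K := AdjoinRoot f) (L := K)
    (by rw [hr, hK])
  refine ⟨φ (AdjoinRoot.root f), ?_⟩
  symm
  apply minpoly.eq_of_irreducible_of_monic hi _ hf
  rw [Polynomial.aeval_algHom_apply]
  simp

/-- Over a finite field of odd order `q`, the number of unordered pairs
`{f, g}` of monic irreducible degree-`m` polynomials with `g = (-1)^m f(-z)`
and `f ≠ g`, plus the number of self-dual monic irreducible degree-`m`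
polynomials, equals the number of orbits of `Z_2 × C_m` acting on `ℤ`-words
with entries in `[-(q-1)/2, (q-1)/2]` (cyclic shift and global negation) on
which the `C_m`-action is free: Reiner's primitive blinking necklaces. -/
theorem card_blinking_necklaces (F : Type*) [Field F] [Fintype F] (q m : ℕ)
    (hq : Fintype.card F = q) (hodd : Odd q) (hm : 1 ≤ m) :
    Nat.card {P : Set F[X] //
        ∃ f : F[X], f.Monic ∧ Irreducible f ∧ f.natDegree = m ∧
          pdual f ≠ f ∧ P = {f, pdual f}} +
      Nat.card {f : F[X] //
        f.Monic ∧ Irreducible f ∧ f.natDegree = m ∧ pdual f = f} =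
    Nat.card {o : Set (Fin m → ℤ) //
        ∃ a : Fin m → ℤ, (∀ i, |a i| ≤ ((q : ℤ) - 1) / 2) ∧
          o = {b | ∃ k : ℕ, b = (cycShift m)^[k] a ∨ b = -((cycShift m)^[k] a)} ∧
          ∀ b ∈ o, ∀ k : ℕ, 0 < k → k < m → (cycShift m)^[k] b ≠ b} := by
  classical
  obtain ⟨p, hp⟩ := CharP.exists F
  haveI : Fact p.Prime := ⟨CharP.char_is_prime F p⟩
  haveI : NeZero m := ⟨by omega⟩
  let K := FiniteField.Extension F p m
  have hK : Module.finrank F K = m := FiniteField.finrank_extension F p m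
  obtain ⟨w, winj, wneg, wfrob, wrange⟩ := exists_word_coding F q m hq hodd hm K hK
  let σ := FiniteField.frobeniusAlgEquivOfAlgebraic F K
  have wit : ∀ (k : ℕ) (x : K), w (σ^[k] x) = (cycShift m)^[k] (w x) := by
    intro k
    induction k with
    | zero => intro x; rfl
    | succ k ih =>
      intro x
      rw [Function.iterate_succ_apply, Function.iterate_succ_apply, ih, wfrob]
  let S : Set K := {x | (minpoly F x).natDegree = m}
  let Φ : K → Set F[X] := fun x => {minpoly F x, minpoly F (-x)}
  let orb : (Fin m → ℤ) → Set (Fin m → ℤ) := fun a =>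
    {b | ∃ k : ℕ, b = (cycShift m)^[k] a ∨ b = -((cycShift m)^[k] a)}
  have hnegit : ∀ (k : ℕ) (x : K), σ^[k] (-x) = -(σ^[k] x) := by
    intro k x
    rw [← AlgEquiv.coe_pow, map_neg]
  have hmem : ∀ x y : K, minpoly F y ∈ Φ x ↔ ∃ k : ℕ, y = σ^[k] x ∨ y = -(σ^[k] x) := by
    intro x y
    simp only [Φ, Set.mem_insert_iff, Set.mem_singleton_iff]
    rw [minpoly_eq_iff_frob_s14 F x y, minpoly_eq_iff_frob_s14 F (-x) y, ← exists_or]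
    simp only [← hnegit]
    rfl
  have horb : ∀ x, orb (w x) = w '' {y | minpoly F y ∈ Φ x} := by
    intro x
    ext b
    simp only [orb, Set.mem_setOf_eq, Set.mem_image]
    constructor
    · rintro ⟨k, h | h⟩
      · exact ⟨σ^[k] x, (hmem _ _).mpr ⟨k, Or.inl rfl⟩, by rw [h, wit]⟩
      · exact ⟨-(σ^[k] x), (hmem _ _).mpr ⟨k, Or.inr rfl⟩, by rw [h, wneg, wit]⟩
    · rintro ⟨y, hy, rfl⟩
      obtain ⟨k, h | h⟩ := (hmem _ _).mp hy
      · exact ⟨k, Or.inl (by rw [h, wit])⟩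
      · exact ⟨k, Or.inr (by rw [h, wneg, wit])⟩
  have hΦeq : ∀ x y, minpoly F y ∈ Φ x → Φ x = Φ y := by
    intro x y h
    simp only [Φ, Set.mem_insert_iff, Set.mem_singleton_iff] at h ⊢
    rcases h with h | h
    · rw [← pdual_minpoly F y, h, pdual_minpoly]
    · rw [← pdual_minpoly F y, h, pdual_minpoly, neg_neg, Set.pair_comm]
  have hkey : ∀ x y, Φ x = Φ y ↔ orb (w x) = orb (w y) := by
    intro x y
    constructor
    · intro h
      rw [horb, horb, h]
    · intro h
      rw [horb, horb] at h
      have h1 := Set.image_injective.mpr winj h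
      have h2 : y ∈ {z | minpoly F z ∈ Φ y} := by simp [Φ]
      rw [← h1] at h2
      exact hΦeq x y h2
  -- the right-hand side
  have hR : {o : Set (Fin m → ℤ) | ∃ a : Fin m → ℤ, (∀ i, |a i| ≤ ((q : ℤ) - 1) / 2) ∧
          o = {b | ∃ k : ℕ, b = (cycShift m)^[k] a ∨ b = -((cycShift m)^[k] a)} ∧
          ∀ b ∈ o, ∀ k : ℕ, 0 < k → k < m → (cycShift m)^[k] b ≠ b}
      = Set.range (fun x : S => orb (w x)) := by
    have hprim : ∀ y, y ∈ S ↔ ∀ k : ℕ, 0 < k → k < m → (cycShift m)^[k] (w y) ≠ w y := by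
      intro y
      simp only [← wit, winj.ne_iff]
      exact natDegree_minpoly_eq_iff_frob F m hK y
    ext o
    simp only [Set.mem_setOf_eq, Set.mem_range, Subtype.exists]
    constructor
    · rintro ⟨a, ha, rfl, h⟩
      obtain ⟨x, rfl⟩ := (wrange a).mp ha
      refine ⟨x, (hprim x).mpr (h _ ⟨0, Or.inl rfl⟩), rfl⟩
    · rintro ⟨x, hx, rfl⟩
      refine ⟨w x, (wrange _).mpr ⟨x, rfl⟩, rfl, ?_⟩
      intro b hb
      rw [horb] at hb
      obtain ⟨y, hy, rfl⟩ := hb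
      rw [← hprim]
      have hx' : (minpoly F x).natDegree = m := hx
      show (minpoly F y).natDegree = m
      rcases hy with h | h
      · rw [h, hx']
      · rw [Set.mem_singleton_iff.mp h, natDegree_minpoly_neg, hx']
  -- the left-hand side
  let A1 : Set (Set F[X]) := {P | ∃ f : F[X], f.Monic ∧ Irreducible f ∧ f.natDegree = m ∧
          pdual f ≠ f ∧ P = {f, pdual f}}
  let A2 : Set F[X] := {f | f.Monic ∧ Irreducible f ∧ f.natDegree = m ∧ pdual f = f}
  have hL : A1 ∪ (fun f : F[X] => ({f} : Set F[X])) '' A2 = Set.range (fun x : S => Φ x) := by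
    ext P
    constructor
    · rintro (⟨f, h1, h2, h3, h4, rfl⟩ | ⟨f, ⟨h1, h2, h3, h4⟩, rfl⟩)
      · obtain ⟨x, rfl⟩ := exists_root_of_degree F (K := K) m hK f h1 h2 h3
        exact ⟨⟨x, h3⟩, by simp only [Φ, pdual_minpoly]⟩
      · obtain ⟨x, rfl⟩ := exists_root_of_degree F (K := K) m hK f h1 h2 h3
        refine ⟨⟨x, h3⟩, ?_⟩
        simp only [Φ, ← pdual_minpoly, h4, Set.pair_eq_singleton]
    · rintro ⟨⟨x, hx⟩, rfl⟩
      have hint : IsIntegral F x := Algebra.IsIntegral.isIntegral x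
      by_cases h : pdual (minpoly F x) = minpoly F x
      · right
        refine ⟨minpoly F x, ⟨minpoly.monic hint, minpoly.irreducible hint, hx, h⟩, ?_⟩
        simp only [Φ, ← pdual_minpoly, h, Set.pair_eq_singleton]
      · left
        refine ⟨minpoly F x, minpoly.monic hint, minpoly.irreducible hint, hx, h, ?_⟩
        simp only [Φ, pdual_minpoly]
  have hfin : (Set.range (fun x : S => Φ x)).Finite := Set.finite_range _
  have hdisj : Disjoint A1 ((fun f : F[X] => ({f} : Set F[X])) '' A2) := by
    rw [Set.disjoint_left]
    rintro P ⟨f, -, -, -, h4, rfl⟩ ⟨g, -, hg⟩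
    have h5 : f ∈ ({g} : Set F[X]) := by
      show f ∈ (fun f : F[X] => ({f} : Set F[X])) g
      rw [hg]; simp
    have h6 : pdual f ∈ ({g} : Set F[X]) := by
      show pdual f ∈ (fun f : F[X] => ({f} : Set F[X])) g
      rw [hg]; simp
    exact h4 (h6.trans h5.symm)
  have hleft : A1.ncard + A2.ncard = (Set.range (fun x : S => Φ x)).ncard := by
    rw [← hL] at hfin ⊢
    rw [Set.ncard_union_eq hdisj (hfin.subset Set.subset_union_left)
      (hfin.subset Set.subset_union_right),
      Set.ncard_image_of_injective _ Set.singleton_injective]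
  have hmid : Nat.card (Set.range (fun x : S => Φ x))
      = Nat.card (Set.range (fun x : S => orb (w x))) := by
    have e1 := Setoid.quotientKerEquivRange (fun x : S => Φ x)
    have e2 := Setoid.quotientKerEquivRange (fun x : S => orb (w x))
    have h : Setoid.ker (fun x : S => Φ x) = Setoid.ker (fun x : S => orb (w x)) := by
      ext x y
      exact hkey x y
    rw [h] at e1
    exact Nat.card_congr (e1.symm.trans e2)
  rw [← hR] at hmid
  exact (hleft.trans (Nat.card_coe_set_eq _).symm).trans hmid
end
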